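/- For every k ≥ 1 and u ∈ ℂ, the homogeneous symmetric function h_k(u) equals the sum, over all compositions λ = (λ_1, …, λ_m) of k (the order of parts matters), of (1 / (a_1 a_2 ⋯ a_m)) • p⁺_{λ_1}(u) * p⁺_{λ_2}(u+a_1) * ⋯ * p⁺_{λ_m}(u+a_{m−1}), where a_i := λ_1 + ⋯ + λ_i, a_0 := 0, and the product is taken in the given order in the (noncommutative) algebra A. -/

import Mathlib

/-- Matrices in the `k`-leg model over `A`: square matrices indexed by functions
`Fin k → Fin n`, a model of `End((ℂ^n)^⊗k) ⊗ A`. -/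
abbrev LegMatrix (n k : ℕ) (A : Type*) := Matrix (Fin k → Fin n) (Fin k → Fin n) A

variable {n : ℕ} {A : Type*} [Ring A] [Algebra ℂ A]

/-- `T_s(v)`: the generating matrix `T(v)` placed on leg `s` of the `k`-leg model. -/
def Tleg (T : ℂ → Matrix (Fin n) (Fin n) A) {k : ℕ} (s : Fin k) (v : ℂ) :
    LegMatrix n k A := fun f g =>
  if ∀ t : Fin k, t ≠ s → f t = g t then T v (f s) (g s) else 0

/-- The permutation matrix `P_σ` of a permutation `σ` of the legs:
its `(f,g)`-entry is `1` (via `algebraMap ℂ A`) if `f = g ∘ σ` and `0` otherwise. -/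
def Pleg (n : ℕ) (A : Type*) [Ring A] [Algebra ℂ A] {k : ℕ} (σ : Equiv.Perm (Fin k)) :
    LegMatrix n k A := fun f g => if f = g ∘ σ then algebraMap ℂ A 1 else 0

/-- The transposition of legs with 1-based labels `i`, `j` (identity if out of range;
all uses are in range). -/
def legSwap (k i j : ℕ) : Equiv.Perm (Fin k) :=
  if h : 1 ≤ i ∧ i ≤ k ∧ 1 ≤ j ∧ j ≤ k then
    Equiv.swap ⟨i - 1, by omega⟩ ⟨j - 1, by omega⟩ else 1

/-- The antisymmetrizer `A_k = (1/k!) • Σ_σ sgn(σ) • P_σ` in the `k`-leg model. -/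
noncomputable def Aleg (n : ℕ) (A : Type*) [Ring A] [Algebra ℂ A] (k : ℕ) :
    LegMatrix n k A :=
  ((k.factorial : ℂ))⁻¹ •
    ∑ σ : Equiv.Perm (Fin k), ((Equiv.Perm.sign σ : ℤ) : ℂ) • Pleg n A σ

/-- The symmetrizer `S_k = (1/k!) • Σ_σ P_σ` in the `k`-leg model. -/
noncomputable def Sleg (n : ℕ) (A : Type*) [Ring A] [Algebra ℂ A] (k : ℕ) :
    LegMatrix n k A :=
  ((k.factorial : ℂ))⁻¹ • ∑ σ : Equiv.Perm (Fin k), Pleg n A σ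

/-- The ordered product `T_1(u) * T_2(u+d) * ⋯ * T_k(u+(k−1)d)` in the `k`-leg model. -/
noncomputable def TT (T : ℂ → Matrix (Fin n) (Fin n) A) (k : ℕ) (u d : ℂ) :
    LegMatrix n k A :=
  ((List.finRange k).map (fun s => Tleg T s (u + d * ((s : ℕ) : ℂ)))).prod

/-- The RTT relation of the Yangian of `gl_n`:
`((u−v) • 1 − P_{1,2}) T_1(u) T_2(v) = T_2(v) T_1(u) ((u−v) • 1 − P_{1,2})`
in the 2-leg model. -/
def RTT (T : ℂ → Matrix (Fin n) (Fin n) A) : Prop :=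
  ∀ u v : ℂ,
    ((u - v) • (1 : LegMatrix n 2 A) - Pleg n A (legSwap 2 1 2)) *
        Tleg T (0 : Fin 2) u * Tleg T (1 : Fin 2) v =
      Tleg T (1 : Fin 2) v * Tleg T (0 : Fin 2) u *
        ((u - v) • (1 : LegMatrix n 2 A) - Pleg n A (legSwap 2 1 2))

/-- The elementary symmetric function
`e_k(u) = trace(A_k * T_1(u) * T_2(u−1) * ⋯ * T_k(u−k+1))`; for `k = 0` this is `1`. -/
noncomputable def esym (T : ℂ → Matrix (Fin n) (Fin n) A) (k : ℕ) (u : ℂ) : A :=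
  Matrix.trace (Aleg n A k * TT T k u (-1))

/-- The homogeneous symmetric function
`h_k(u) = trace(S_k * T_1(u) * T_2(u+1) * ⋯ * T_k(u+k−1))`; for `k = 0` this is `1`. -/
noncomputable def hsym (T : ℂ → Matrix (Fin n) (Fin n) A) (k : ℕ) (u : ℂ) : A :=
  Matrix.trace (Sleg n A k * TT T k u 1)

/-- The power sum `p⁻_k(u) = trace(T(u) * T(u−1) * ⋯ * T(u−k+1))`,
an ordinary product of `n×n` matrices over `A`. -/
noncomputable def pminus (T : ℂ → Matrix (Fin n) (Fin n) A) (k : ℕ) (u : ℂ) : A :=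
  Matrix.trace (((List.finRange k).map (fun i => T (u - ((i : ℕ) : ℂ)))).prod)

/-- The power sum `p⁺_k(u) = trace(T(u) * T(u+1) * ⋯ * T(u+k−1))`,
an ordinary product of `n×n` matrices over `A`. -/
noncomputable def pplus (T : ℂ → Matrix (Fin n) (Fin n) A) (k : ℕ) (u : ℂ) : A :=
  Matrix.trace (((List.finRange k).map (fun i => T (u + ((i : ℕ) : ℂ)))).prod)

/-- Entries of an ordered product of one-leg matrices over pairwise distinct legs. -/
lemma prod_map_Tleg_apply (T : ℂ → Matrix (Fin n) (Fin n) A) {k : ℕ} (w : Fin k → ℂ)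
    (l : List (Fin k)) (hl : l.Nodup) (f g : Fin k → Fin n) :
    (l.map fun s => Tleg T s (w s)).prod f g =
      if ∀ t, t ∉ l → f t = g t then (l.map fun s => T (w s) (f s) (g s)).prod else 0 := by
  induction l generalizing f with
  | nil => simp [Matrix.one_apply, funext_iff]
  | cons s l ih =>
    obtain ⟨hs, hl⟩ := List.nodup_cons.1 hl
    simp only [List.map_cons, List.prod_cons, Matrix.mul_apply, ih hl]
    rw [Finset.sum_eq_single (Function.update f s (g s))]
    · have hprod : (l.map fun t => T (w t) (Function.update f s (g s) t) (g t)) =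
          l.map fun t => T (w t) (f t) (g t) := by
        refine List.map_congr_left fun t ht => ?_
        rw [Function.update_of_ne (by rintro rfl; exact hs ht)]
      have hcond : (∀ t, t ∉ l → Function.update f s (g s) t = g t) ↔
          ∀ t, t ∉ s :: l → f t = g t := by
        constructor
        · intro h t ht
          rw [List.mem_cons, not_or] at ht
          simpa [Function.update_of_ne ht.1] using h t ht.2
        · intro h t ht
          by_cases hts : t = s
          · subst hts; simp
          · rw [Function.update_of_ne hts]
            exact h t (by simp [hts, ht])
      have hleg : Tleg T s (w s) f (Function.update f s (g s)) = T (w s) (f s) (g s) := by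
        unfold Tleg
        rw [if_pos fun t ht => (Function.update_of_ne ht _ _).symm, Function.update_self]
      rw [hprod, hleg]
      simp only [hcond, mul_ite, mul_zero]
    · intro h _ hne
      unfold Tleg
      by_cases h1 : ∀ t, t ≠ s → f t = h t
      · rw [if_neg (fun h2 : ∀ t, t ∉ l → h t = g t => hne ?_), mul_zero]
        funext t
        by_cases hts : t = s
        · subst hts; simp [h2 t hs]
        · rw [Function.update_of_ne hts, h1 t hts]
      · rw [if_neg h1, zero_mul]
    · simp

lemma TT_apply (T : ℂ → Matrix (Fin n) (Fin n) A) (k : ℕ) (u : ℂ) (f g : Fin k → Fin n) :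
    TT T k u 1 f g = (List.ofFn fun s : Fin k => T (u + (s : ℕ)) (f s) (g s)).prod := by
  unfold TT
  rw [prod_map_Tleg_apply T (fun s : Fin k => u + 1 * ((s : ℕ) : ℂ)) _ (List.nodup_finRange k)]
  simp [List.ofFn_eq_map]

lemma Pleg_mul_apply {k : ℕ} (σ : Equiv.Perm (Fin k)) (M : LegMatrix n k A)
    (f g : Fin k → Fin n) : (Pleg n A σ * M) f g = M (f ∘ σ.symm) g := by
  rw [Matrix.mul_apply, Finset.sum_eq_single (f ∘ σ.symm)]
  · simp [Pleg, Function.comp_assoc]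
  · intro h _ hne
    rw [Pleg, if_neg, zero_mul]
    rintro rfl
    exact hne (by simp [Function.comp_assoc])
  · simp

lemma mul_Pleg_apply {k : ℕ} (σ : Equiv.Perm (Fin k)) (M : LegMatrix n k A)
    (f g : Fin k → Fin n) : (M * Pleg n A σ) f g = M f (g ∘ σ) := by
  rw [Matrix.mul_apply, Finset.sum_eq_single (g ∘ σ)]
  · simp [Pleg]
  · intro h _ hne
    rw [Pleg, if_neg hne, mul_zero]
  · simp

/-- The RTT relation at `v`, `v + 1`, entrywise: symmetrizing in the row indices makes the
product symmetric in the column indices. -/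
lemma RTT.symm_apply {T : ℂ → Matrix (Fin n) (Fin n) A} (hT : RTT T) (v : ℂ)
    (a b c d : Fin n) :
    T v a c * T (v + 1) b d + T v b c * T (v + 1) a d =
      T v a d * T (v + 1) b c + T v b d * T (v + 1) a c := by
  have h01 (x y : ℂ) (f g : Fin 2 → Fin n) :
      (Tleg T (0 : Fin 2) x * Tleg T (1 : Fin 2) y) f g =
        T x (f 0) (g 0) * T y (f 1) (g 1) := by
    have := prod_map_Tleg_apply T ![x, y] [0, 1] (by simp) f g
    simpa [Fin.forall_fin_two] using this
  have h10 (x y : ℂ) (f g : Fin 2 → Fin n) :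
      (Tleg T (1 : Fin 2) y * Tleg T (0 : Fin 2) x) f g =
        T y (f 1) (g 1) * T x (f 0) (g 0) := by
    have := prod_map_Tleg_apply T ![x, y] [1, 0] (by simp) f g
    simpa [Fin.forall_fin_two] using this
  have hswap : legSwap 2 1 2 = Equiv.swap 0 1 := by simp [legSwap]
  have key (a b c d : Fin n) : T v a c * T (v + 1) b d + T v b c * T (v + 1) a d =
      T (v + 1) b d * T v a c + T (v + 1) b c * T v a d := by
    have h := congrFun (congrFun (hT v (v + 1)) ![a, b]) ![c, d]
    rw [mul_assoc, sub_mul, mul_sub, hswap, Matrix.sub_apply, Matrix.sub_apply,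
      Pleg_mul_apply, mul_Pleg_apply, smul_mul_assoc, mul_smul_comm, one_mul, mul_one,
      Matrix.smul_apply, Matrix.smul_apply, h01, h01, h10, h10] at h
    simp only [sub_add_cancel_left, neg_smul, one_smul, Function.comp_apply,
      Equiv.symm_swap, Equiv.swap_apply_left, Equiv.swap_apply_right, Matrix.cons_val_zero,
      Matrix.cons_val_one] at h
    rw [← neg_add', ← neg_add', neg_inj] at h
    exact h
  rw [key a b c d, key a b d c, add_comm]

/-- The `(f,g)`-entry of `k! • S_k * T_1(u) * ⋯ * T_k(u+k−1)`, written out. -/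
def symmEntry (T : ℂ → Matrix (Fin n) (Fin n) A) (u : ℂ) (k : ℕ) (f g : Fin k → Fin n) : A :=
  ∑ σ : Equiv.Perm (Fin k), (List.ofFn fun s : Fin k => T (u + (s : ℕ)) (f (σ s)) (g s)).prod

lemma hsym_eq_sum_symmEntry (T : ℂ → Matrix (Fin n) (Fin n) A) (k : ℕ) (u : ℂ) :
    hsym T k u = ((k.factorial : ℂ))⁻¹ • ∑ f, symmEntry T u k f f := by
  unfold hsym Sleg symmEntry
  rw [smul_mul_assoc, Matrix.trace_smul, Matrix.trace]
  congr 1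
  refine Finset.sum_congr rfl fun f _ => ?_
  rw [Matrix.diag_apply, Finset.sum_mul, Matrix.sum_apply]
  refine Fintype.sum_equiv (Equiv.inv _) _ _ fun σ => ?_
  rw [Pleg_mul_apply, TT_apply]
  rfl

lemma symmEntry_comp_left (T : ℂ → Matrix (Fin n) (Fin n) A) (u : ℂ) {k : ℕ}
    (f g : Fin k → Fin n) (τ : Equiv.Perm (Fin k)) :
    symmEntry T u k (f ∘ τ) g = symmEntry T u k f g :=
  Fintype.sum_equiv (Equiv.mulLeft τ) _ _ fun _ => rfl

/-- Splitting an ordered product over `Fin k` around two neighbouring factors. -/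
lemma exists_prod_ofFn_eq {k : ℕ} (i : ℕ) (hi : i + 1 < k) (F : Fin k → A) :
    ∃ L R : A, ∀ G : Fin k → A,
      (∀ s : Fin k, (s : ℕ) ≠ i → (s : ℕ) ≠ i + 1 → G s = F s) →
      (List.ofFn G).prod = L * (G ⟨i, by omega⟩ * G ⟨i + 1, hi⟩) * R := by
  refine ⟨((List.ofFn F).take i).prod, ((List.ofFn F).drop (i + 2)).prod, fun G hG => ?_⟩
  have hsplit : List.ofFn G = (List.ofFn G).take i ++
      (G ⟨i, by omega⟩ :: G ⟨i + 1, hi⟩ :: (List.ofFn G).drop (i + 2)) := by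
    conv_lhs => rw [← List.take_append_drop i (List.ofFn G)]
    rw [List.drop_eq_getElem_cons (by simp; omega), List.drop_eq_getElem_cons (by simp; omega)]
    simp
  have htake : (List.ofFn G).take i = (List.ofFn F).take i := by
    refine List.ext_getElem (by simp) fun j h1 h2 => ?_
    simp only [List.length_take, List.length_ofFn, lt_inf_iff] at h1
    simp only [List.getElem_take, List.getElem_ofFn]
    exact hG _ (by simp; omega) (by simp; omega)
  have hdrop : (List.ofFn G).drop (i + 2) = (List.ofFn F).drop (i + 2) := by
    refine List.ext_getElem (by simp) fun j h1 h2 => ?_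
    simp only [List.getElem_drop, List.getElem_ofFn]
    exact hG _ (by simp; omega) (by simp; omega)
  rw [hsplit, htake, hdrop]
  simp [mul_assoc]

lemma symmEntry_comp_adjacent_swap {T : ℂ → Matrix (Fin n) (Fin n) A} (hT : RTT T) (u : ℂ)
    {k : ℕ} (i : ℕ) (hi : i + 1 < k) (f g : Fin k → Fin n) :
    symmEntry T u k f (g ∘ Equiv.swap ⟨i, by omega⟩ ⟨i + 1, hi⟩) = symmEntry T u k f g := by
  set p : Fin k := ⟨i, by omega⟩ with hp
  set q : Fin k := ⟨i + 1, hi⟩ with hq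
  let E (σ : Equiv.Perm (Fin k)) (g : Fin k → Fin n) : A :=
    (List.ofFn fun s : Fin k => T (u + (s : ℕ)) (f (σ s)) (g s)).prod
  have hpair (σ : Equiv.Perm (Fin k)) :
      E σ (g ∘ Equiv.swap p q) + E (σ * Equiv.swap p q) (g ∘ Equiv.swap p q) =
        E σ g + E (σ * Equiv.swap p q) g := by
    obtain ⟨L, R, h⟩ := exists_prod_ofFn_eq i hi
      fun s : Fin k => T (u + (s : ℕ)) (f (σ s)) (g s)
    have hne (s : Fin k) (h1 : (s : ℕ) ≠ i) (h2 : (s : ℕ) ≠ i + 1) :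
        Equiv.swap p q s = s :=
      Equiv.swap_apply_of_ne_of_ne (fun e => h1 (by rw [e])) (fun e => h2 (by rw [e]))
    have hrel := hT.symm_apply (u + i) (f (σ p)) (f (σ q)) (g p) (g q)
    simp only [E]
    rw [h _ fun s h1 h2 => by simp [hne s h1 h2], h _ fun s h1 h2 => by simp [hne s h1 h2],
      h _ fun s h1 h2 => rfl, h _ fun s h1 h2 => by simp [hne s h1 h2]]
    simp only [← hp, ← hq, Function.comp_apply, Equiv.swap_apply_left, Equiv.swap_apply_right,
      Equiv.Perm.mul_apply, ← add_mul, ← mul_add]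
    have hpv : ((p : ℕ) : ℂ) = i := rfl
    have hqv : u + ((q : ℕ) : ℂ) = u + i + 1 := by simp [hq, add_assoc]
    rw [hpv, hqv, hrel]
  have hsum (g : Fin k → Fin n) :
      ∑ σ, (E σ g + E (σ * Equiv.swap p q) g) = (2 : ℂ) • symmEntry T u k f g := by
    rw [Finset.sum_add_distrib,
      Fintype.sum_equiv (Equiv.mulRight (Equiv.swap p q))
        (fun σ => E (σ * Equiv.swap p q) g) (fun σ => E σ g) fun _ => rfl, two_smul]
    rfl
  refine smul_right_injective A (two_ne_zero (α := ℂ)) ?_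
  simp only
  rw [← hsum, ← hsum]
  exact Finset.sum_congr rfl fun σ _ => hpair σ

lemma symmEntry_comp_right {T : ℂ → Matrix (Fin n) (Fin n) A} (hT : RTT T) (u : ℂ) {k : ℕ}
    (f g : Fin k → Fin n) (τ : Equiv.Perm (Fin k)) :
    symmEntry T u k f (g ∘ τ) = symmEntry T u k f g := by
  cases k with
  | zero => rw [Subsingleton.elim τ 1]; rfl
  | succ k =>
    have hτ : τ ∈ Submonoid.closure
        (Set.range fun i : Fin k => Equiv.swap i.castSucc i.succ) := by
      rw [Equiv.Perm.mclosure_swap_castSucc_succ]; trivial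
    induction hτ using Submonoid.closure_induction generalizing g with
    | mem x hx =>
      obtain ⟨i, rfl⟩ := hx
      exact symmEntry_comp_adjacent_swap hT u (i : ℕ) (by omega) f g
    | one => rfl
    | mul x y _ _ hx hy =>
      rw [Equiv.Perm.coe_mul, ← Function.comp_assoc, hy, hx]

/-- Expansion of the symmetrized product along the image of the last leg. -/
lemma symmEntry_succ (T : ℂ → Matrix (Fin n) (Fin n) A) (u : ℂ) (m : ℕ)
    (f g : Fin (m + 1) → Fin n) :
    symmEntry T u (m + 1) f g =
      symmEntry T u m (f ∘ Fin.castSucc) (g ∘ Fin.castSucc) *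
          T (u + m) (f (Fin.last m)) (g (Fin.last m)) +
        ∑ j : Fin m,
          symmEntry T u m (Function.update (f ∘ Fin.castSucc) j (f (Fin.last m)))
            (g ∘ Fin.castSucc) * T (u + m) (f j.castSucc) (g (Fin.last m)) := by
  have hE (f : Fin (m + 1) → Fin n) (σ : Equiv.Perm (Option (Fin m))) :
      (List.ofFn fun s : Fin (m + 1) =>
        T (u + (s : ℕ)) (f (finSuccEquivLast.symm (σ (finSuccEquivLast s)))) (g s)).prod =
      (List.ofFn fun s : Fin m => T (u + (s : ℕ))
        (f (finSuccEquivLast.symm (σ (some s)))) (g s.castSucc)).prod *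
        T (u + m) (f (finSuccEquivLast.symm (σ none))) (g (Fin.last m)) := by
    rw [List.ofFn_succ']
    simp
  unfold symmEntry
  rw [Fintype.sum_equiv (finSuccEquivLast.permCongr.trans Equiv.Perm.decomposeOption) _
    (fun x : Option (Fin m) × Equiv.Perm (Fin m) =>
      (List.ofFn fun s : Fin (m + 1) => T (u + (s : ℕ)) (f (finSuccEquivLast.symm
        (Equiv.Perm.decomposeOption.symm x (finSuccEquivLast s)))) (g s)).prod)
    (fun σ => by simp [Equiv.permCongr_apply])]
  rw [Fintype.sum_prod_type, Fintype.sum_option]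
  simp only [hE]
  congr 1
  · simp [Finset.sum_mul]
  · refine Finset.sum_congr rfl fun j _ => ?_
    simp only [Equiv.Perm.decomposeOption_symm_apply, Equiv.Perm.mul_apply,
      Equiv.optionCongr_apply, Option.map_none, Option.map_some, Equiv.swap_apply_left,
      finSuccEquivLast_symm_some, ← Finset.sum_mul]
    congr 1
    refine Finset.sum_congr rfl fun σ _ => ?_
    congr 2
    funext s
    congr 1
    by_cases hs : σ s = j
    · simp [hs]
    · rw [Equiv.swap_apply_of_ne_of_ne (by simp) (by simpa using hs)]
      simp [Function.update_of_ne hs]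

/-- The trace of `(m+1)! • S_{m+1} * T_1(u) * ⋯ * T_{m+1}(u+m) * X_{m+1}`, where `X` acts on the
last leg. -/
def symmTrace (T : ℂ → Matrix (Fin n) (Fin n) A) (u : ℂ) (m : ℕ)
    (X : Matrix (Fin n) (Fin n) A) : A :=
  ∑ f : Fin (m + 1) → Fin n, ∑ b,
    symmEntry T u (m + 1) (Function.update f (Fin.last m) b) f * X (f (Fin.last m)) b

lemma symmTrace_one (T : ℂ → Matrix (Fin n) (Fin n) A) (u : ℂ) (m : ℕ) :
    symmTrace T u m 1 = ∑ f, symmEntry T u (m + 1) f f := by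
  simp [symmTrace, Matrix.one_apply]

/-- By symmetry, `X` may be moved from any leg to the last one. -/
lemma sum_symmEntry_update {T : ℂ → Matrix (Fin n) (Fin n) A} (hT : RTT T) (u : ℂ) (m : ℕ)
    (X : Matrix (Fin n) (Fin n) A) (j : Fin (m + 1)) :
    ∑ f : Fin (m + 1) → Fin n, ∑ b,
      symmEntry T u (m + 1) (Function.update f j b) f * X (f j) b = symmTrace T u m X := by
  refine Fintype.sum_equiv
    ((Equiv.swap j (Fin.last m)).arrowCongr (Equiv.refl (Fin n))) _ _ fun f => ?_
  refine Finset.sum_congr rfl fun b _ => ?_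
  have hf : (Equiv.swap j (Fin.last m)).arrowCongr (Equiv.refl (Fin n)) f =
      f ∘ Equiv.swap j (Fin.last m) := by
    funext s; simp [Equiv.arrowCongr]
  have hup : Function.update (f ∘ Equiv.swap j (Fin.last m)) (Fin.last m) b =
      Function.update f j b ∘ Equiv.swap j (Fin.last m) := by
    rw [Function.update_comp_equiv]
    simp
  rw [hf, hup, symmEntry_comp_left, symmEntry_comp_right hT]
  simp

lemma symmTrace_eq_add (T : ℂ → Matrix (Fin n) (Fin n) A) (u : ℂ) (m : ℕ)
    (X : Matrix (Fin n) (Fin n) A) :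
    symmTrace T u m X =
      (∑ f, symmEntry T u m f f) * Matrix.trace (T (u + m) * X) +
        ∑ j : Fin m, ∑ f : Fin m → Fin n, ∑ b,
          symmEntry T u m (Function.update f j b) f * (T (u + m) * X) (f j) b := by
  unfold symmTrace
  rw [← (Fin.snocEquiv fun _ : Fin (m + 1) => Fin n).sum_comp, Fintype.sum_prod_type]
  have hcomp (a : Fin n) (f : Fin m → Fin n) :
      (Fin.snoc f a : Fin (m + 1) → Fin n) ∘ Fin.castSucc = f := by
    funext s; simp
  have hterm (a b : Fin n) (f : Fin m → Fin n) :
      symmEntry T u (m + 1)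
        (Function.update (Fin.snoc f a : Fin (m + 1) → Fin n) (Fin.last m) b)
        (Fin.snoc f a : Fin (m + 1) → Fin n) * X a b =
      symmEntry T u m f f * (T (u + m) b a * X a b) +
        ∑ j : Fin m, symmEntry T u m (Function.update f j b) f *
          (T (u + m) (f j) a * X a b) := by
    rw [Fin.update_snoc_last, symmEntry_succ, hcomp, hcomp]
    simp [add_mul, Finset.sum_mul, mul_assoc]
  have hsnoc (a : Fin n) (f : Fin m → Fin n) :
      (Fin.snocEquiv fun _ : Fin (m + 1) => Fin n) (a, f) = Fin.snoc f a := rfl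
  simp only [hsnoc, Fin.snoc_last, hterm, Finset.sum_add_distrib]
  congr 1
  · rw [Finset.sum_mul, Finset.sum_comm]
    refine Finset.sum_congr rfl fun f _ => ?_
    simp only [Matrix.trace, Matrix.diag_apply, Matrix.mul_apply, Finset.mul_sum]
    exact Finset.sum_comm
  · simp only [Matrix.mul_apply, Finset.mul_sum]
    rw [Finset.sum_comm]
    conv_rhs => rw [Finset.sum_comm]
    refine Finset.sum_congr rfl fun f _ => ?_
    rw [Finset.sum_comm]
    conv_rhs => rw [Finset.sum_comm]
    exact Finset.sum_congr rfl fun b _ => Finset.sum_comm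

lemma symmTrace_eq_sum {T : ℂ → Matrix (Fin n) (Fin n) A} (hT : RTT T) (u : ℂ) (m : ℕ)
    (X : Matrix (Fin n) (Fin n) A) :
    ((m.factorial : ℂ))⁻¹ • symmTrace T u m X =
      ∑ i ∈ Finset.range (m + 1), hsym T i u *
        Matrix.trace ((List.ofFn fun s : Fin (m + 1 - i) => T (u + i + (s : ℕ))).prod * X) := by
  induction m generalizing X with
  | zero =>
    rw [symmTrace_eq_add]
    simp [hsym_eq_sum_symmEntry]
  | succ m ih =>
    rw [symmTrace_eq_add, Finset.sum_range_succ, add_comm (_ * _), smul_add]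
    congr 1
    · simp only [sum_symmEntry_update hT, Finset.sum_const, Finset.card_univ, Fintype.card_fin]
      rw [← Nat.cast_smul_eq_nsmul ℂ, smul_smul, Nat.factorial_succ]
      have hc : (((m + 1) * m.factorial : ℕ) : ℂ)⁻¹ * ((m + 1 : ℕ) : ℂ) =
          (m.factorial : ℂ)⁻¹ := by
        have h1 : ((m + 1 : ℕ) : ℂ) ≠ 0 := by exact_mod_cast m.succ_ne_zero
        rw [Nat.cast_mul, mul_inv, mul_comm, ← mul_assoc, mul_inv_cancel₀ h1, one_mul]
      rw [hc, ih]
      refine Finset.sum_congr rfl fun i hi => ?_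
      have hi : i ≤ m := by simpa [Nat.lt_succ_iff] using hi
      obtain ⟨d, rfl⟩ := Nat.exists_eq_add_of_le hi
      rw [show i + d + 1 - i = d + 1 by omega, show i + d + 1 + 1 - i = d + 1 + 1 by omega,
        List.ofFn_succ' (n := d + 1)]
      simp [mul_assoc, add_assoc]
    · rw [show m + 1 + 1 - (m + 1) = 1 by omega]
      rw [← smul_mul_assoc, ← hsym_eq_sum_symmEntry]
      simp

lemma pplus_eq_trace_ofFn (T : ℂ → Matrix (Fin n) (Fin n) A) (k : ℕ) (u : ℂ) :
    pplus T k u = Matrix.trace (List.ofFn fun s : Fin k => T (u + (s : ℕ))).prod := by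
  have h : (List.ofFn fun s : Fin k => T (u + (s : ℕ))) =
      (List.range k).map fun i : ℕ => T (u + i) := by
    refine List.ext_getElem (by simp) fun i h1 h2 => ?_
    simp
  rw [h]
  simp [pplus, ← List.map_eq_flatMap]

/-- Newton's identity for `h_k` and `p⁺_k`. -/
lemma hsym_succ {T : ℂ → Matrix (Fin n) (Fin n) A} (hT : RTT T) (u : ℂ) (m : ℕ) :
    hsym T (m + 1) u = ((m + 1 : ℕ) : ℂ)⁻¹ •
      ∑ i ∈ Finset.range (m + 1), hsym T i u * pplus T (m + 1 - i) (u + i) := by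
  have h := symmTrace_eq_sum hT u m 1
  simp only [mul_one] at h
  simp only [pplus_eq_trace_ofFn]
  rw [← h, symmTrace_one, hsym_eq_sum_symmEntry, smul_smul, Nat.factorial_succ, Nat.cast_mul,
    mul_inv]

/-- The summand attached to a list of parts. -/
noncomputable def partsTerm (T : ℂ → Matrix (Fin n) (Fin n) A) (u : ℂ) (l : List ℕ) : A :=
  ((1 : ℂ) / ∏ i ∈ Finset.range l.length, (((l.take (i + 1)).sum : ℕ) : ℂ)) •
    (l.mapIdx fun i b => pplus T b (u + (((l.take i).sum : ℕ) : ℂ))).prod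

lemma partsTerm_concat (T : ℂ → Matrix (Fin n) (Fin n) A) (u : ℂ) (l : List ℕ) (b : ℕ) :
    partsTerm T u (l ++ [b]) =
      ((l.sum + b : ℕ) : ℂ)⁻¹ • (partsTerm T u l * pplus T b (u + (l.sum : ℕ))) := by
  have hprod : ∏ i ∈ Finset.range l.length, ((((l ++ [b]).take (i + 1)).sum : ℕ) : ℂ) =
      ∏ i ∈ Finset.range l.length, (((l.take (i + 1)).sum : ℕ) : ℂ) := by
    refine Finset.prod_congr rfl fun i hi => ?_
    rw [List.take_append_of_le_length (by simpa using hi)]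
  have hmap : (l.mapIdx fun i c => pplus T c (u + ((((l ++ [b]).take i).sum : ℕ) : ℂ))) =
      l.mapIdx fun i c => pplus T c (u + (((l.take i).sum : ℕ) : ℂ)) := by
    refine List.ext_getElem (by simp) fun i h1 h2 => ?_
    simp only [List.length_mapIdx] at h1
    simp only [List.getElem_mapIdx]
    rw [List.take_append_of_le_length h1.le]
  unfold partsTerm
  rw [List.length_append, List.length_singleton, Finset.prod_range_succ, hprod,
    List.mapIdx_append, hmap, smul_mul_assoc, smul_smul]
  congr 1
  · simp [mul_comm]
  · simp

/-- A nonempty composition is a composition of a smaller number followed by a last part. -/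
lemma sum_composition_succ (F : List ℕ → A) (m : ℕ) :
    ∑ c : Composition (m + 1), F c.blocks =
      ∑ i : Fin (m + 1), ∑ c : Composition (i : ℕ), F (c.blocks ++ [m + 1 - i]) := by
  rw [← Fintype.sum_sigma' fun (i : Fin (m + 1)) (c : Composition (i : ℕ)) =>
    F (c.blocks ++ [m + 1 - i])]
  symm
  refine Fintype.sum_bijective (fun x : (i : Fin (m + 1)) × Composition (i : ℕ) =>
    (⟨x.2.blocks ++ [m + 1 - x.1], ?_, ?_⟩ : Composition (m + 1))) ⟨?_, ?_⟩ _ _ fun _ => rfl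
  · intro b hb
    rcases List.mem_append.1 hb with hb | hb
    · exact x.2.blocks_pos hb
    · rw [List.mem_singleton] at hb
      omega
  · simp only [List.sum_append, x.2.blocks_sum, List.sum_singleton]
    omega
  · rintro ⟨i, c⟩ ⟨j, d⟩ h
    have hb : c.blocks ++ [m + 1 - (i : ℕ)] = d.blocks ++ [m + 1 - (j : ℕ)] :=
      congrArg Composition.blocks h
    obtain ⟨h1, h2⟩ := List.append_inj' hb rfl
    have hij : i = j := by
      apply Fin.ext
      rw [← c.blocks_sum, ← d.blocks_sum, h1]
    subst hij
    rw [Composition.ext h1]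
  · intro c
    rcases List.eq_nil_or_concat c.blocks with h | ⟨l, b, h⟩
    · have := c.blocks_sum
      simp [h] at this
    · have hs : l.sum + b = m + 1 := by
        rw [← c.blocks_sum, h]; simp
      have hb : 0 < b := c.blocks_pos (by simp [h])
      refine ⟨⟨⟨l.sum, by omega⟩, ⟨l, fun {x} hx => c.blocks_pos (by simp [h, hx]), rfl⟩⟩,
        Composition.ext ?_⟩
      refine Eq.trans ?_ (h.trans List.concat_eq_append).symm
      change l ++ [m + 1 - l.sum] = l ++ [b]
      rw [← hs, Nat.add_sub_cancel_left]

lemma hsym_eq_sum_partsTerm {T : ℂ → Matrix (Fin n) (Fin n) A} (hT : RTT T) (u : ℂ) (k : ℕ) :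
    hsym T k u = ∑ c : Composition k, partsTerm T u c.blocks := by
  induction k using Nat.strong_induction_on with
  | _ k ih =>
    cases k with
    | zero =>
      rw [hsym_eq_sum_symmEntry, Fintype.sum_eq_single (Composition.ones 0)]
      · simp [symmEntry, partsTerm, Composition.ones]
      · intro c hc
        refine absurd (Composition.ext ?_) hc
        have h : c.blocks = [] := List.length_eq_zero_iff.1 (Nat.le_zero.1 c.length_le)
        simp [h, Composition.ones]
    | succ m =>
      rw [hsym_succ hT, sum_composition_succ, Finset.sum_range, Finset.smul_sum]
      refine Finset.sum_congr rfl fun i _ => ?_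
      rw [ih i i.isLt, Finset.sum_mul, Finset.smul_sum]
      refine Finset.sum_congr rfl fun c _ => ?_
      rw [partsTerm_concat, c.blocks_sum, Nat.add_sub_cancel' i.isLt.le]

/-- `h_k(u)` as a sum over all compositions `λ = (λ_1,…,λ_m)` of `k` of
`(1/(a_1⋯a_m)) • p⁺_{λ_1}(u) * p⁺_{λ_2}(u+a_1) * ⋯ * p⁺_{λ_m}(u+a_{m−1})`,
where `a_i = λ_1 + ⋯ + λ_i`. -/
theorem hsym_eq_sum_compositions (hn : 1 ≤ n) (T : ℂ → Matrix (Fin n) (Fin n) A)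
    (hT : RTT T) (k : ℕ) (hk : 1 ≤ k) (u : ℂ) :
    hsym T k u =
      ∑ c : Composition k,
        ((1 : ℂ) / ∏ i ∈ Finset.range c.length, ((c.sizeUpTo (i + 1) : ℕ) : ℂ)) •
          ((List.finRange c.length).map (fun i : Fin c.length =>
            pplus T (c.blocksFun i) (u + ((c.sizeUpTo (i : ℕ) : ℕ) : ℂ)))).prod := by
  rw [hsym_eq_sum_partsTerm hT]
  refine Finset.sum_congr rfl fun c _ => ?_
  unfold partsTerm
  congr 2
  refine List.ext_getElem (by simp) fun i h1 h2 => ?_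
  simp [Composition.blocksFun, Composition.sizeUpTo]
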